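/- arXiv:1407.7010 — 6 statements merged into one kernel-verified Lean document; each statement's English description precedes it below -/
import Mathlib

section
/- No two distinct alphabetic formulas over the alphabet 𝒜 are unifiable: if A and B are 𝒜-formulas and some substitution instance of A equals some substitution instance of B, then A = B. -/
/-- Propositional formulas over the signature {→}. -/
inductive Fm : Type
  | var : ℕ → Fm
  | imp : Fm → Fm → Fm
  deriving DecidableEq

/-- Apply a substitution (uniform replacement of variables by formulas). -/
def Fm.subst (σ : ℕ → Fm) : Fm → Fm
  | var n => σ n
  | imp A B => imp (A.subst σ) (B.subst σ)

/-- Derivability from a set of axioms by modus ponens and substitution. -/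
inductive Deriv (P : Set Fm) : Fm → Prop
  | ax {A : Fm} : A ∈ P → Deriv P A
  | mp {A B : Fm} : Deriv P A → Deriv P (A.imp B) → Deriv P B
  | subst (σ : ℕ → Fm) {A : Fm} : Deriv P A → Deriv P (A.subst σ)

/-- The fixed variable x⁰. -/
def x0 : Fm := Fm.var 0

/-- Axioms of the intuitionistic implicational calculus Int_{→}:
A1: x → (y → x), A2: (x → (y → z)) → ((x → y) → (x → z)). -/
def IntAx : Set Fm :=
  { Fm.imp (Fm.var 0) (Fm.imp (Fm.var 1) (Fm.var 0)),
    Fm.imp (Fm.imp (Fm.var 0) (Fm.imp (Fm.var 1) (Fm.var 2)))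
      (Fm.imp (Fm.imp (Fm.var 0) (Fm.var 1)) (Fm.imp (Fm.var 0) (Fm.var 2))) }

/-- A ∨ B abbreviates (A → B) → B. -/
def orF (A B : Fm) : Fm := (A.imp B).imp B

/-- E 0 = x⁰ → x⁰ (i.e. E_1), E (k+1) = E k → x⁰. -/
def E : ℕ → Fm
  | 0 => x0.imp x0
  | n + 1 => (E n).imp x0

/-- The code of the letter a_i (letters are elements of `Fin m`). -/
def code {m : ℕ} (i : Fin m) : Fm := (E i.val).imp (x0.imp (x0.imp x0))

/-- The formula ▷ = ((x⁰ → x⁰) → x⁰) → x⁰. -/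
def tri : Fm := ((x0.imp x0).imp x0).imp x0

/-- Right-nested disjunction of a nonempty list of formulas. -/
def rlist : List Fm → Fm
  | [] => x0
  | [A] => A
  | A :: B :: Bs => orF A (rlist (B :: Bs))

def llistAux : Fm → List Fm → Fm
  | A, [] => A
  | A, B :: Bs => llistAux (orF A B) Bs

/-- Left-nested disjunction of a nonempty list of formulas. -/
def llist : List Fm → Fm
  | [] => x0
  | A :: As => llistAux A As

/-- \overrightarrow{α}: right-nested disjunction of codes of the letters of α. -/
def rword {m : ℕ} (w : List (Fin m)) : Fm := rlist (w.map code)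

/-- \overleftarrow{α}: left-nested disjunction of codes of the letters of α. -/
def lword {m : ℕ} (w : List (Fin m)) : Fm := llist (w.map code)

/-- A substitution instance of a member of M. -/
def SubStar (M : Set Fm) : Set Fm := {F | ∃ A ∈ M, ∃ σ : ℕ → Fm, F = Fm.subst σ A}

/-- Two formulas are unifiable if they have a common substitution instance. -/
def Unifiable (A B : Fm) : Prop := ∃ σ τ : ℕ → Fm, Fm.subst σ A = Fm.subst τ B

/-- The variable v occurs in a formula. -/
def Occurs (v : ℕ) : Fm → Prop
  | Fm.var w => v = w
  | Fm.imp A B => Occurs v A ∨ Occurs v B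

/-- Alphabetic formulas (𝒜-formulas) over the alphabet `Fin m`. -/
inductive AForm (m : ℕ) : Fm → Prop
  | ofCode (i : Fin m) : AForm m (code i)
  | ofOr {A B : Fm} : AForm m A → AForm m B → AForm m (orF A B)

/-- A tag system ⟨𝒜, 𝒲, d⟩ with 𝒜 = Fin m. -/
structure TagSystem where
  m : ℕ
  W : Fin m → List (Fin m)
  d : ℕ

/-- One production step of the tag system: a_i β γ ↦ γ ω_i, |β| = d - 1. -/
def TagStep (T : TagSystem) (ξ ζ : List (Fin T.m)) : Prop :=
  ∃ (i : Fin T.m) (β γ : List (Fin T.m)),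
    β.length = T.d - 1 ∧ ξ = i :: (β ++ γ) ∧ ζ = γ ++ T.W i

/-- ⟹_T : reflexive–transitive closure of the one-step production. -/
def TagSteps (T : TagSystem) : List (Fin T.m) → List (Fin T.m) → Prop :=
  Relation.ReflTransGen (TagStep T)

/-- T halts on α: α produces some word shorter than d. -/
def Halts (T : TagSystem) (α : List (Fin T.m)) : Prop :=
  ∃ β, TagSteps T α β ∧ β.length < T.d

/-- Axioms R1: (▷ → (y ∨ \overrightarrow{az}) ∨ u) → (▷ → (\overleftarrow{ya} ∨ z) ∨ u),
with y = var 1, z = var 2, u = var 3. -/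
def R1Ax (m : ℕ) : Set Fm :=
  {F | ∃ a : Fin m, F =
    (tri.imp (orF (orF (Fm.var 1) (orF (code a) (Fm.var 2))) (Fm.var 3))).imp
      (tri.imp (orF (orF (orF (Fm.var 1) (code a)) (Fm.var 2)) (Fm.var 3)))}

/-- Axioms R2: (▷ → \overleftarrow{ya} ∨ z) → (▷ → y ∨ \overrightarrow{az}). -/
def R2Ax (m : ℕ) : Set Fm :=
  {F | ∃ a : Fin m, F =
    (tri.imp (orF (orF (Fm.var 1) (code a)) (Fm.var 2))).imp
      (tri.imp (orF (Fm.var 1) (orF (code a) (Fm.var 2))))}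

/-- Axioms T1: (▷ → \overrightarrow{a_i α y}) → (▷ → \overrightarrow{y ω_i}), |α| = d - 1. -/
def T1Ax (T : TagSystem) : Set Fm :=
  {F | ∃ (i : Fin T.m) (α : List (Fin T.m)), α.length = T.d - 1 ∧
    F = (tri.imp (rlist (((i :: α).map code) ++ [Fm.var 1]))).imp
      (tri.imp (rlist (Fm.var 1 :: (T.W i).map code)))}

/-- Axioms T2: (▷ → \overrightarrow{a_i α}) → (▷ → \overrightarrow{ω_i}), |α| = d - 1. -/
def T2Ax (T : TagSystem) : Set Fm :=
  {F | ∃ (i : Fin T.m) (α : List (Fin T.m)), α.length = T.d - 1 ∧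
    F = (tri.imp (rword (i :: α))).imp (tri.imp (rword (T.W i)))}

/-- P_T = T1 ∪ T2 ∪ R1 ∪ R2. -/
def PT (T : TagSystem) : Set Fm := T1Ax T ∪ T2Ax T ∪ R1Ax T.m ∪ R2Ax T.m

/-- Axioms H: (▷ → \overrightarrow{α}) → A for 0 < |α| < d and A ∈ P₀. -/
def HAx (T : TagSystem) (P₀ : Finset Fm) : Set Fm :=
  {F | ∃ (α : List (Fin T.m)) (A : Fm), 0 < α.length ∧ α.length < T.d ∧ A ∈ P₀ ∧
    F = (tri.imp (rword α)).imp A}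

/-- P_{T,P₀} = P_T ∪ H. -/
def PTP (T : TagSystem) (P₀ : Finset Fm) : Set Fm := PT T ∪ HAx T P₀

/-- The calculus P_{T,ω,P₀} = {W_ω} ∪ P_T ∪ H. -/
def PTot (T : TagSystem) (ω : List (Fin T.m)) (P₀ : Finset Fm) : Set Fm :=
  insert (tri.imp (rword ω)) (PTP T P₀)

/-- Code(α): the four types of codes of a nonempty word α. -/
def CodeSet {m : ℕ} (α : List (Fin m)) : Set Fm :=
  {F | F = tri.imp (rword α)} ∪
  {F | ∃ α₁ α₂ : List (Fin m), α = α₁ ++ α₂ ∧ 2 ≤ α₁.length ∧ 1 ≤ α₂.length ∧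
    F = tri.imp (orF (rword α₁) (rword α₂))} ∪
  {F | ∃ α₁ α₂ α₃ : List (Fin m), α = α₁ ++ α₂ ++ α₃ ∧
    2 ≤ α₁.length ∧ 2 ≤ α₂.length ∧ 1 ≤ α₃.length ∧
    F = tri.imp (orF (orF (lword α₁) (rword α₂)) (rword α₃))} ∪
  {F | ∃ α₁ α₂ : List (Fin m), α = α₁ ++ α₂ ∧ 3 ≤ α₁.length ∧ 1 ≤ α₂.length ∧
    F = tri.imp (orF (lword α₁) (rword α₂))}

/-- Code_T(ω)*: substitution instances of codes of words produced from ω by T. -/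
def CodeTStar (T : TagSystem) (ω : List (Fin T.m)) : Set Fm :=
  {F | ∃ β, TagSteps T ω β ∧ F ∈ SubStar (CodeSet β)}

/-- ⟨P⟩: one application of modus ponens or substitution to members of P. -/
def StepSet (P : Set Fm) : Set Fm :=
  {B | ∃ A, A ∈ P ∧ A.imp B ∈ P} ∪ {B | ∃ A ∈ P, ∃ σ : ℕ → Fm, B = Fm.subst σ A}

/-- ⟨P⟩_n. -/
def Stages (P : Set Fm) : ℕ → Set Fm
  | 0 => P
  | n + 1 => StepSet (Stages P n)

theorem E_subst_right (σ : ℕ → Fm) (n : ℕ) : ∃ X : Fm, Fm.subst σ (E n) = X.imp (σ 0) := by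
  cases n with
  | zero => exact ⟨σ 0, rfl⟩
  | succ k => exact ⟨Fm.subst σ (E k), rfl⟩

theorem fm_ne_right (s X : Fm) : s ≠ X.imp (s.imp s) := by
  intro h
  have := congrArg sizeOf h
  simp at this
  omega

theorem E_size_lt (σ : ℕ → Fm) {i j : ℕ} (h : i < j) :
    sizeOf (Fm.subst σ (E i)) < sizeOf (Fm.subst σ (E j)) := by
  induction h with
  | refl => simp [E, Fm.subst]; omega
  | step _ ih => simp [E, Fm.subst] at ih ⊢; omega

theorem E_subst_congr (σ τ : ℕ → Fm) (h : σ 0 = τ 0) (n : ℕ) :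
    Fm.subst σ (E n) = Fm.subst τ (E n) := by
  induction n with
  | zero => simp [E, Fm.subst, x0, h]
  | succ k ih => simp [E, Fm.subst, x0, h, ih]

theorem code_ne_or {m : ℕ} (i : Fin m) (A B : Fm) (σ τ : ℕ → Fm) :
    Fm.subst σ (code i) ≠ Fm.subst τ (orF A B) := by
  intro h
  obtain ⟨X, hX⟩ := E_subst_right σ i.val
  simp only [code, orF, Fm.subst, x0, hX, Fm.imp.injEq] at h
  exact fm_ne_right _ _ (h.1.2.trans h.2.symm)

theorem aform_unif {m : ℕ} {A : Fm} (hA : AForm m A) :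
    ∀ B, AForm m B → ∀ σ τ : ℕ → Fm, Fm.subst σ A = Fm.subst τ B → A = B := by
  induction hA with
  | ofCode i =>
    intro B hB σ τ h
    cases hB with
    | ofCode j =>
      simp only [code, Fm.subst, x0, Fm.imp.injEq] at h
      have h1 := h.1
      rw [E_subst_congr σ τ h.2.1] at h1
      have hij : i.val = j.val := by
        rcases lt_trichotomy i.val j.val with hl | he | hl
        · have := E_size_lt τ hl
          rw [h1] at this
          omega
        · exact he
        · have := E_size_lt τ hl
          rw [h1] at this
          omega
      rw [Fin.ext hij]
    | ofOr _ _ => exact absurd h (code_ne_or _ _ _ _ _)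
  | ofOr _ _ ihA ihB =>
    intro B hB σ τ h
    cases hB with
    | ofCode j => exact absurd h.symm (code_ne_or _ _ _ _ _)
    | ofOr hC hD =>
      simp only [orF, Fm.subst, Fm.imp.injEq] at h
      rw [ihA _ hC σ τ h.1.1, ihB _ hD σ τ h.2]

/-- No two distinct alphabetic formulas are unifiable. -/
theorem stmt_4 (m : ℕ) (A B : Fm) (hA : AForm m A) (hB : AForm m B)
    (h : Unifiable A B) : A = B := by
  obtain ⟨σ, τ, h⟩ := h
  exact aform_unif hA B hB σ τ h
end

section
/- For all nonempty words ξ, β, ζ over 𝒜, the formula ▷ → \overleftarrow{ξβ} ∨ \overrightarrow{ζ} is derivable from the set of axioms R1 (for all letters a ∈ 𝒜) together with the formula ▷ → (\overleftarrow{ξ} ∨ \overrightarrow{β}) ∨ \overrightarrow{ζ}, by modus ponens and substitution. -/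
theorem E_subst (σ : ℕ → Fm) (h : σ 0 = Fm.var 0) (n : ℕ) : (E n).subst σ = E n := by
  induction n with
  | zero => simp [E, x0, Fm.subst, h]
  | succ n ih => simp [E, x0, Fm.subst, h, ih]

theorem r1_step {m : ℕ} {P : Set Fm} (hP : R1Ax m ⊆ P) (a : Fin m) (Y Z U : Fm)
    (h : Deriv P (tri.imp (orF (orF Y (orF (code a) Z)) U))) :
    Deriv P (tri.imp (orF (orF (orF Y (code a)) Z) U)) := by
  let σ : ℕ → Fm := fun n =>
    match n with
    | 1 => Y
    | 2 => Z
    | 3 => U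
    | n => Fm.var n
  have hc : (code a).subst σ = code a := by
    simp [code, x0, Fm.subst, E_subst σ rfl, σ]
  have ht : tri.subst σ = tri := rfl
  have h1 := Deriv.subst σ (Deriv.ax (hP ⟨a, rfl⟩))
  simp only [Fm.subst, orF, hc, ht] at h1
  exact Deriv.mp h h1

theorem r1_steps {m : ℕ} {P : Set Fm} (hP : R1Ax m ⊆ P) (U : Fm) (β : List (Fin m)) :
    ∀ (a : Fin m) (Y : Fm), Deriv P (tri.imp (orF (orF Y (rlist ((a :: β).map code))) U)) →
      Deriv P (tri.imp (orF (llistAux Y ((a :: β).map code)) U)) := by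
  induction β with
  | nil => intro a Y h; exact h
  | cons b β ih =>
    intro a Y h
    exact ih b (orF Y (code a)) (r1_step hP a Y _ U h)

theorem llistAux_append (As Bs : List Fm) :
    ∀ A, llistAux A (As ++ Bs) = llistAux (llistAux A As) Bs := by
  induction As with
  | nil => intro A; rfl
  | cons B As ih => intro A; exact ih _

/-- R1, ▷ → (\overleftarrow{ξ} ∨ \overrightarrow{β}) ∨ \overrightarrow{ζ} ⊢
    ▷ → \overleftarrow{ξβ} ∨ \overrightarrow{ζ}, for nonempty ξ, β, ζ. -/
theorem stmt_7 (m : ℕ) (ξ β ζ : List (Fin m)) (hξ : ξ ≠ []) (hβ : β ≠ []) (hζ : ζ ≠ []) :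
    Deriv (R1Ax m ∪ {tri.imp (orF (orF (lword ξ) (rword β)) (rword ζ))})
      (tri.imp (orF (lword (ξ ++ β)) (rword ζ))) := by
  obtain ⟨x, ξ, rfl⟩ := List.exists_cons_of_ne_nil hξ
  obtain ⟨b, β, rfl⟩ := List.exists_cons_of_ne_nil hβ
  have h := r1_steps (P := R1Ax m ∪ {tri.imp (orF (orF (lword (x :: ξ)) (rword (b :: β))) (rword ζ))})
    Set.subset_union_left (rword ζ) β b (lword (x :: ξ)) (Deriv.ax (Or.inr rfl))
  have e : lword (x :: ξ ++ b :: β) = llistAux (lword (x :: ξ)) ((b :: β).map code) := by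
    simp only [lword, List.cons_append, List.map_cons, List.map_append, llist]
    exact llistAux_append _ _ _
  rw [e]
  exact h
end

section
/- Let T = ⟨𝒜, 𝒲, d⟩ be a tag system with all words ω_i nonempty. For all nonempty words ξ, ζ over 𝒜, if T produces ζ from ξ in one step (ξ ↦_T ζ), then the formula ▷ → \overrightarrow{ζ} is derivable from P_T together with the formula ▷ → \overrightarrow{ξ}, by modus ponens and substitution. -/
/-- The substitution fixing `x⁰` and sending the variables 1, 2, 3 to `Y`, `Z`, `U`. -/
def sub3 (Y Z U : Fm) : ℕ → Fm
  | 1 => Y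
  | 2 => Z
  | 3 => U
  | n => Fm.var n

theorem subst_x0 (Y Z U : Fm) : x0.subst (sub3 Y Z U) = x0 := rfl

theorem subst_E (Y Z U : Fm) (n : ℕ) : (E n).subst (sub3 Y Z U) = E n := by
  induction n with
  | zero => rfl
  | succ n ih => simp only [E, Fm.subst, ih, subst_x0]

theorem subst_code (Y Z U : Fm) {m : ℕ} (a : Fin m) :
    (code a).subst (sub3 Y Z U) = code a := by
  simp only [code, Fm.subst, subst_E, subst_x0]

theorem subst_tri (Y Z U : Fm) : tri.subst (sub3 Y Z U) = tri := rfl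

theorem subst_orF (σ : ℕ → Fm) (A B : Fm) :
    (orF A B).subst σ = orF (A.subst σ) (B.subst σ) := rfl

theorem subst_rlist (σ : ℕ → Fm) (l : List Fm) (hl : l ≠ []) :
    (rlist l).subst σ = rlist (l.map (Fm.subst σ)) := by
  induction l with
  | nil => exact absurd rfl hl
  | cons A l ih =>
    cases l with
    | nil => rfl
    | cons B l =>
      have := ih (by simp)
      simp only [rlist, List.map_cons, subst_orF] at this ⊢
      rw [this]

theorem map_subst_code (Y Z U : Fm) {m : ℕ} (w : List (Fin m)) :
    (w.map code).map (Fm.subst (sub3 Y Z U)) = w.map code := by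
  simp [subst_code]

theorem rlist_cons (A : Fm) (l : List Fm) (hl : l ≠ []) :
    rlist (A :: l) = orF A (rlist l) := by
  cases l with
  | nil => exact absurd rfl hl
  | cons B l => rfl

theorem rlist_append (l l' : List Fm) (hl' : l' ≠ []) :
    rlist (l ++ [rlist l']) = rlist (l ++ l') := by
  induction l with
  | nil => rfl
  | cons A l ih =>
    rw [List.cons_append, List.cons_append, rlist_cons _ _ (by simp),
      rlist_cons _ _ (by simp [hl']), ih]

theorem r1 {T : TagSystem} {P : Set Fm} (hP : PT T ⊆ P) (a : Fin T.m) (Y Z U : Fm)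
    (h : Deriv P (tri.imp (orF (orF Y (orF (code a) Z)) U))) :
    Deriv P (tri.imp (orF (orF (orF Y (code a)) Z) U)) := by
  have := Deriv.subst (sub3 Y Z U) (Deriv.ax (hP (Or.inl (Or.inr ⟨a, rfl⟩))))
  simp only [Fm.subst, subst_orF, subst_code, subst_tri, sub3] at this
  exact h.mp this

theorem r2 {T : TagSystem} {P : Set Fm} (hP : PT T ⊆ P) (a : Fin T.m) (Y Z : Fm)
    (h : Deriv P (tri.imp (orF (orF Y (code a)) Z))) :
    Deriv P (tri.imp (orF Y (orF (code a) Z))) := by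
  have := Deriv.subst (sub3 Y Z Z) (Deriv.ax (hP (Or.inr ⟨a, rfl⟩)))
  simp only [Fm.subst, subst_orF, subst_code, subst_tri, sub3] at this
  exact h.mp this

theorem reassoc {T : TagSystem} {P : Set Fm} (hP : PT T ⊆ P) (v : List (Fin T.m)) (hv : v ≠ [])
    (w : List (Fin T.m)) : ∀ (Y : Fm), w ≠ [] →
    Deriv P (tri.imp (orF (orF Y (rword w)) (rword v))) →
    Deriv P (tri.imp (orF Y (rword (w ++ v)))) := by
  induction w with
  | nil => intro Y hw; exact absurd rfl hw
  | cons a w ih =>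
    intro Y _ h
    have e : rword (a :: w ++ v) = orF (code a) (rword (w ++ v)) := by
      simp only [rword, List.cons_append, List.map_cons]
      exact rlist_cons _ _ (by simp [hv])
    rw [e]
    apply r2 hP
    by_cases hw : w = []
    · subst hw; exact h
    · apply ih _ hw
      apply r1 hP
      have e' : rword (a :: w) = orF (code a) (rword w) := by
        simp only [rword, List.map_cons]
        exact rlist_cons _ _ (by simp [hw])
      rwa [e'] at h

/-- If ξ ↦_T ζ then P_T, ▷ → \overrightarrow{ξ} ⊢ ▷ → \overrightarrow{ζ}. -/
theorem stmt_11 (T : TagSystem) (hW : ∀ i, T.W i ≠ []) (hd : 1 ≤ T.d)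
    (ξ ζ : List (Fin T.m)) (hξ : ξ ≠ []) (hζ : ζ ≠ []) (h : TagStep T ξ ζ) :
    Deriv (PT T ∪ {tri.imp (rword ξ)}) (tri.imp (rword ζ)) := by
  obtain ⟨i, β, γ, hβ, rfl, rfl⟩ := h
  set P := PT T ∪ {tri.imp (rword (i :: (β ++ γ)))} with hPdef
  have hP : PT T ⊆ P := Set.subset_union_left
  have h0 : Deriv P (tri.imp (rword (i :: (β ++ γ)))) := Deriv.ax (Or.inr rfl)
  by_cases hγ : γ = []
  · subst hγ
    rw [List.append_nil] at h0
    exact h0.mp (Deriv.ax (hP (Or.inl (Or.inl (Or.inr ⟨i, β, hβ, rfl⟩)))))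
  · have h1 := Deriv.subst (sub3 (rword γ) x0 x0)
      (Deriv.ax (hP (Or.inl (Or.inl (Or.inl ⟨i, β, hβ, rfl⟩)))))
    simp only [Fm.subst, subst_tri] at h1
    rw [subst_rlist _ _ (by simp), subst_rlist _ _ (by simp), List.map_append,
      map_subst_code, List.map_cons (a := Fm.var 1) (l := (T.W i).map code), map_subst_code] at h1
    have e : ([Fm.var 1].map (Fm.subst (sub3 (rword γ) x0 x0))) = [rlist (γ.map code)] := rfl
    have e' : (Fm.var 1).subst (sub3 (rword γ) x0 x0) = rword γ := rfl
    rw [e, e', rlist_append _ _ (by simp [hγ]), rlist_cons _ _ (by simp [hW])] at h1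
    have h2 : Deriv P (tri.imp (orF (rword γ) (rword (T.W i)))) := by
      refine h0.mp ?_
      simpa [rword] using h1
    cases γ with
    | nil => exact absurd rfl hγ
    | cons b γ =>
      have eb : rword (b :: γ ++ T.W i) = orF (code b) (rword (γ ++ T.W i)) := by
        simp only [rword, List.cons_append, List.map_cons]
        exact rlist_cons _ _ (by simp [hW])
      rw [eb]
      by_cases hg : γ = []
      · subst hg; exact h2
      · apply reassoc hP _ (hW i) _ _ hg
        have e3 : rword (b :: γ) = orF (code b) (rword γ) := by
          simp only [rword, List.map_cons]
          exact rlist_cons _ _ (by simp [hg])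
        rwa [e3] at h2
end

section
/- Let T = ⟨𝒜, 𝒲, d⟩ be a tag system with all words ω_i nonempty and ω a nonempty word over 𝒜. Every formula derivable from the calculus P_{T,ω} = P_T ∪ {▷ → \overrightarrow{ω}} is derivable in the intuitionistic implicational calculus Int_{→}. -/
theorem int_K (A B : Fm) : Deriv IntAx (A.imp (B.imp A)) := by
  have h : Deriv IntAx (Fm.imp (Fm.var 0) (Fm.imp (Fm.var 1) (Fm.var 0))) :=
    Deriv.ax (by simp [IntAx])
  exact Deriv.subst (fun n => match n with | 0 => A | _ => B) h

theorem int_S (A B C : Fm) :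
    Deriv IntAx ((A.imp (B.imp C)).imp ((A.imp B).imp (A.imp C))) := by
  have h : Deriv IntAx (Fm.imp (Fm.imp (Fm.var 0) (Fm.imp (Fm.var 1) (Fm.var 2)))
      (Fm.imp (Fm.imp (Fm.var 0) (Fm.var 1)) (Fm.imp (Fm.var 0) (Fm.var 2)))) :=
    Deriv.ax (by simp [IntAx])
  exact Deriv.subst (fun n => match n with | 0 => A | 1 => B | _ => C) h

theorem int_weak {A : Fm} (B : Fm) (h : Deriv IntAx A) : Deriv IntAx (B.imp A) :=
  Deriv.mp h (int_K A B)

theorem int_I (A : Fm) : Deriv IntAx (A.imp A) :=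
  Deriv.mp (int_K A A) (Deriv.mp (int_K A (A.imp A)) (int_S A (A.imp A) A))

theorem int_or_right (A : Fm) {B : Fm} (h : Deriv IntAx B) : Deriv IntAx (orF A B) :=
  int_weak _ h

theorem int_or_left {A : Fm} (B : Fm) (h : Deriv IntAx A) : Deriv IntAx (orF A B) :=
  Deriv.mp (int_weak (A.imp B) h) (Deriv.mp (int_I (A.imp B)) (int_S (A.imp B) A B))

theorem int_code {m : ℕ} (i : Fin m) : Deriv IntAx (code i) :=
  int_weak _ (int_K _ _)

theorem int_rword {m : ℕ} (w : List (Fin m)) (hw : w ≠ []) : Deriv IntAx (rword w) := by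
  cases w with
  | nil => exact absurd rfl hw
  | cons a w =>
    cases w with
    | nil => exact int_code a
    | cons b w => exact int_or_left _ (int_code a)

/-- Every formula derivable from P_{T,ω} = P_T ∪ {▷ → \overrightarrow{ω}}
    is derivable in Int_{→}. -/
theorem stmt_13 (T : TagSystem) (hW : ∀ i, T.W i ≠ []) (hd : 1 ≤ T.d)
    (ω : List (Fin T.m)) (hω : ω ≠ []) (A : Fm)
    (h : Deriv (insert (tri.imp (rword ω)) (PT T)) A) : Deriv IntAx A := by
  induction h with
  | mp _ _ ih1 ih2 => exact Deriv.mp ih1 ih2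
  | subst σ _ ih => exact Deriv.subst σ ih
  | ax hA =>
    rcases hA with rfl | ((hA | hA) | hA) | hA
    · exact int_weak _ (int_rword ω hω)
    · obtain ⟨i, α, _, rfl⟩ := hA
      refine int_weak _ (int_weak _ ?_)
      have h1 := int_rword _ (hW i)
      have h2 := hW i
      unfold rword at h1
      generalize T.W i = w at h1 h2
      cases w with
      | nil => exact absurd rfl h2
      | cons b w => exact int_or_right _ h1
    · obtain ⟨i, α, _, rfl⟩ := hA
      exact int_weak _ (int_weak _ (int_rword _ (hW i)))
    · obtain ⟨a, rfl⟩ := hA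
      exact int_weak _ (int_weak _ (int_or_left _ (int_or_left _ (int_or_right _ (int_code a)))))
    · obtain ⟨a, rfl⟩ := hA
      exact int_weak _ (int_weak _ (int_or_right _ (int_or_left _ (int_code a))))
end

section
/- Let T = ⟨𝒜, 𝒲, d⟩ be a tag system with all words ω_i nonempty, ω a nonempty word over 𝒜, and P₀ a finite set of formulas such that every formula derivable in Int_{→} is derivable from P₀. Then every formula derivable from the calculus P_{T,ω,P₀} is derivable from P₀ (i.e., P_{T,ω,P₀} ≤ P₀). -/
namespace Aux

theorem axK (A B : Fm) : Deriv IntAx (A.imp (B.imp A)) := by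
  have h : Deriv IntAx (Fm.imp (Fm.var 0) (Fm.imp (Fm.var 1) (Fm.var 0))) :=
    Deriv.ax (Or.inl rfl)
  exact Deriv.subst (fun n => if n = 0 then A else B) h

theorem axS (A B C : Fm) :
    Deriv IntAx ((A.imp (B.imp C)).imp ((A.imp B).imp (A.imp C))) := by
  have h : Deriv IntAx (Fm.imp (Fm.imp (Fm.var 0) (Fm.imp (Fm.var 1) (Fm.var 2)))
      (Fm.imp (Fm.imp (Fm.var 0) (Fm.var 1)) (Fm.imp (Fm.var 0) (Fm.var 2)))) :=
    Deriv.ax (Or.inr rfl)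
  exact Deriv.subst (fun n => if n = 0 then A else if n = 1 then B else C) h

theorem weak {A : Fm} (B : Fm) (h : Deriv IntAx A) : Deriv IntAx (B.imp A) :=
  Deriv.mp h (axK A B)

theorem ident (A : Fm) : Deriv IntAx (A.imp A) :=
  Deriv.mp (axK A A) (Deriv.mp (axK A (A.imp A)) (axS A (A.imp A) A))

theorem orR {B : Fm} (A : Fm) (h : Deriv IntAx B) : Deriv IntAx (orF A B) := weak _ h

theorem orL {A : Fm} (B : Fm) (h : Deriv IntAx A) : Deriv IntAx (orF A B) :=
  Deriv.mp (weak (A.imp B) h) (Deriv.mp (ident (A.imp B)) (axS (A.imp B) A B))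

theorem code_deriv {m : ℕ} (i : Fin m) : Deriv IntAx (code i) :=
  weak _ (weak _ (ident x0))

theorem rlist_deriv (l : List Fm) (h : ∃ A ∈ l, Deriv IntAx A) : Deriv IntAx (rlist l) := by
  induction l with
  | nil => simp at h
  | cons A l ih =>
    cases l with
    | nil => simpa [rlist] using h
    | cons B l =>
      obtain ⟨C, hC, hd⟩ := h
      rcases List.mem_cons.1 hC with rfl | hC
      · exact orL _ hd
      · exact orR _ (ih ⟨C, hC, hd⟩)

theorem rword_deriv {m : ℕ} (w : List (Fin m)) (h : w ≠ []) : Deriv IntAx (rword w) := by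
  obtain ⟨i, hi⟩ := List.exists_mem_of_ne_nil w h
  exact rlist_deriv _ ⟨code i, List.mem_map_of_mem hi, code_deriv i⟩

end Aux

/-- If Int_{→} ≤ P₀ then P_{T,ω,P₀} ≤ P₀. -/
theorem stmt_14 (T : TagSystem) (hW : ∀ i, T.W i ≠ []) (hd : 1 ≤ T.d)
    (ω : List (Fin T.m)) (hω : ω ≠ []) (P₀ : Finset Fm)
    (hx0 : ∀ A ∈ P₀, ¬ Occurs 0 A)
    (hInt : ∀ A : Fm, Deriv IntAx A → Deriv (↑P₀) A)
    (A : Fm) (h : Deriv (PTot T ω P₀) A) : Deriv (↑P₀) A := by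
  induction h with
  | mp _ _ h1 h2 => exact Deriv.mp h1 h2
  | subst σ _ h1 => exact Deriv.subst σ h1
  | ax hA =>
    rcases hA with rfl | ((((⟨i, α, _, rfl⟩ | ⟨i, α, _, rfl⟩) | ⟨a, rfl⟩) | ⟨a, rfl⟩) |
      ⟨α, B, _, _, hB, rfl⟩)
    · exact hInt _ (Aux.weak _ (Aux.rword_deriv ω hω))
    · obtain ⟨j, hj⟩ := List.exists_mem_of_ne_nil _ (hW i)
      exact hInt _ (Aux.weak _ (Aux.weak _ (Aux.rlist_deriv _
        ⟨code j, List.mem_cons_of_mem _ (List.mem_map_of_mem hj), Aux.code_deriv j⟩)))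
    · exact hInt _ (Aux.weak _ (Aux.weak _ (Aux.rword_deriv _ (hW i))))
    · exact hInt _ (Aux.weak _ (Aux.weak _ (Aux.orL _ (Aux.orL _ (Aux.orR _
        (Aux.code_deriv a))))))
    · exact hInt _ (Aux.weak _ (Aux.weak _ (Aux.orR _ (Aux.orL _ (Aux.code_deriv a)))))
    · exact Deriv.mp (Deriv.ax hB) (hInt _ (Aux.axK _ _))
end

section
/- Let T = ⟨𝒜, 𝒲, d⟩ be a tag system with all words ω_i nonempty, ω a nonempty word over 𝒜, and P₀ a finite set of formulas in which the variable x⁰ does not occur. For every nonempty word α over 𝒜 and every natural number n ≤ N_ω, if some substitution instance of a formula of Code(α) lies in ⟨P_{T,ω,P₀}⟩_n, then ω ⟹_T α. -/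
/-! ### Helper material -/

/-- Size of a formula. -/
def fsz : Fm → ℕ
  | Fm.var _ => 1
  | Fm.imp A B => fsz A + fsz B + 1

theorem fsz_pos (A : Fm) : 0 < fsz A := by cases A <;> simp [fsz]

/-- Instance of `E k` with `x0` replaced by `X`. -/
def EX (X : Fm) : ℕ → Fm
  | 0 => X.imp X
  | n + 1 => (EX X n).imp X

def codeX (X : Fm) {m : ℕ} (i : Fin m) : Fm := (EX X i.val).imp (X.imp (X.imp X))

def triX (X : Fm) : Fm := ((X.imp X).imp X).imp X

/-- Binary trees of letters. -/
inductive Tr (m : ℕ) : Type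
  | leaf : Fin m → Tr m
  | node : Tr m → Tr m → Tr m

def Tr.interp {m : ℕ} (X : Fm) : Tr m → Fm
  | Tr.leaf i => codeX X i
  | Tr.node s t => orF (s.interp X) (t.interp X)

def Tr.flat {m : ℕ} : Tr m → List (Fin m)
  | Tr.leaf i => [i]
  | Tr.node s t => s.flat ++ t.flat

theorem EX_subst (X : Fm) (σ : ℕ → Fm) (k : ℕ) : (EX X k).subst σ = EX (X.subst σ) k := by
  induction k with
  | zero => rfl
  | succ k ih => simp [EX, Fm.subst, ih]

theorem E_eq (k : ℕ) : E k = EX x0 k := by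
  induction k with
  | zero => rfl
  | succ k ih => simp [EX, E, ih]

theorem x0_subst (σ : ℕ → Fm) : x0.subst σ = σ 0 := rfl

theorem code_eq {m : ℕ} : (code : Fin m → Fm) = codeX x0 := by
  funext i
  simp [code, codeX, E_eq]

theorem codeX_subst {m : ℕ} (X : Fm) (σ : ℕ → Fm) (i : Fin m) :
    (codeX X i).subst σ = codeX (X.subst σ) i := by
  simp [codeX, Fm.subst, EX_subst]

theorem code_subst {m : ℕ} (σ : ℕ → Fm) (i : Fin m) : (code i).subst σ = codeX (σ 0) i := by
  rw [code_eq, codeX_subst, x0_subst]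

theorem tri_subst (σ : ℕ → Fm) : tri.subst σ = triX (σ 0) := rfl

theorem triX_subst (X : Fm) (σ : ℕ → Fm) : (triX X).subst σ = triX (X.subst σ) := rfl

theorem orF_subst (A B : Fm) (σ : ℕ → Fm) :
    (orF A B).subst σ = orF (A.subst σ) (B.subst σ) := rfl

theorem interp_subst {m : ℕ} (X : Fm) (σ : ℕ → Fm) (t : Tr m) :
    (t.interp X).subst σ = t.interp (X.subst σ) := by
  induction t with
  | leaf i => exact codeX_subst X σ i
  | node s t hs ht => simp [Tr.interp, orF_subst, hs, ht]

theorem subst_id (A : Fm) : A.subst Fm.var = A := by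
  induction A with
  | var n => rfl
  | imp A B hA hB => simp [Fm.subst, hA, hB]

theorem subst_comp (A : Fm) (σ τ : ℕ → Fm) :
    (A.subst σ).subst τ = A.subst (fun n => (σ n).subst τ) := by
  induction A with
  | var n => rfl
  | imp A B hA hB => simp [Fm.subst, hA, hB]

theorem rlist_subst (σ : ℕ → Fm) : ∀ l : List Fm, l ≠ [] →
    (rlist l).subst σ = rlist (l.map (Fm.subst σ))
  | [], h => absurd rfl h
  | [A], _ => rfl
  | A :: B :: Bs, _ => by
    have := rlist_subst σ (B :: Bs) (by simp)
    simp only [rlist, List.map_cons, orF_subst] at this ⊢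
    rw [this]

theorem rword_subst {m : ℕ} (σ : ℕ → Fm) (w : List (Fin m)) (hw : w ≠ []) :
    (rword w).subst σ = rlist (w.map (codeX (σ 0))) := by
  rw [rword, rlist_subst σ _ (by simpa using hw), List.map_map]
  congr 2
  funext i
  exact code_subst σ i

theorem EX_size (X : Fm) (k : ℕ) : fsz X < fsz (EX X k) := by
  cases k <;> simp [EX, fsz]

theorem EX_inj (X : Fm) : ∀ k l : ℕ, EX X k = EX X l → k = l
  | 0, 0, _ => rfl
  | 0, l + 1, h => by
    have := EX_size X l
    simp only [EX, Fm.imp.injEq] at h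
    rw [← h.1] at this
    omega
  | k + 1, 0, h => by
    have := EX_size X k
    simp only [EX, Fm.imp.injEq] at h
    rw [h.1] at this
    omega
  | k + 1, l + 1, h => by
    simp only [EX, Fm.imp.injEq] at h
    rw [EX_inj X k l h.1]

theorem codeX_inj {m : ℕ} (X : Fm) (i j : Fin m) (h : codeX X i = codeX X j) : i = j := by
  simp only [codeX, Fm.imp.injEq] at h
  exact Fin.ext (EX_inj X _ _ h.1)

theorem codeX_ne_orF {m : ℕ} (X : Fm) (i : Fin m) (A B : Fm) : codeX X i ≠ orF A B := by
  intro h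
  simp only [codeX, orF, Fm.imp.injEq] at h
  obtain ⟨h1, h2⟩ := h
  have hB : B = X := by
    cases hi : i.val with
    | zero => rw [hi] at h1; simp only [EX, Fm.imp.injEq] at h1; exact h1.2.symm
    | succ k => rw [hi] at h1; simp only [EX, Fm.imp.injEq] at h1; exact h1.2.symm
  rw [hB] at h2
  have := congrArg fsz h2
  simp only [fsz] at this
  omega

theorem orF_inj {A B C D : Fm} (h : orF A B = orF C D) : A = C ∧ B = D := by
  simp only [orF, Fm.imp.injEq] at h
  exact h.1

theorem interp_orF {m : ℕ} {X A B : Fm} {t : Tr m} (h : t.interp X = orF A B) :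
    ∃ r s, t = Tr.node r s ∧ r.interp X = A ∧ s.interp X = B := by
  cases t with
  | leaf i => exact absurd h (codeX_ne_orF X i A B)
  | node r s => exact ⟨r, s, rfl, orF_inj h⟩

theorem interp_code {m : ℕ} {X : Fm} {t : Tr m} {i : Fin m} (h : t.interp X = codeX X i) :
    t = Tr.leaf i := by
  cases t with
  | leaf j => rw [codeX_inj X j i h]
  | node r s => exact absurd h.symm (codeX_ne_orF X i _ _)

theorem interp_inj {m : ℕ} (X : Fm) (s t : Tr m) (h : s.interp X = t.interp X) : s = t := by
  induction t generalizing s with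
  | leaf i => exact interp_code h
  | node a b ha hb =>
    obtain ⟨r, q, rfl, h1, h2⟩ := interp_orF h
    rw [ha r h1, hb q h2]

theorem triX_inj {X Y : Fm} (h : triX X = triX Y) : X = Y := by
  simp only [triX, Fm.imp.injEq] at h
  exact h.2

theorem triX_ne (X Y D : Fm) : triX X ≠ (triX Y).imp D := by
  intro h
  simp only [triX, Fm.imp.injEq] at h
  obtain ⟨⟨⟨h1, h2⟩, -⟩, -⟩ := h
  have e1 := congrArg fsz h1
  have e2 := congrArg fsz h2
  simp only [fsz] at e1
  omega

theorem triX_ne' (X Y D G : Fm) : triX X ≠ ((triX Y).imp D).imp G := by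
  intro h
  simp only [triX, Fm.imp.injEq] at h
  obtain ⟨⟨⟨h1, h2⟩, -⟩, -⟩ := h
  have e1 := congrArg fsz h1
  have e2 := congrArg fsz h2
  simp only [fsz] at e1
  omega

/-- A right-nested disjunction of codes is a tree. -/
theorem rlist_tree {m : ℕ} (X : Fm) : ∀ w : List (Fin m), w ≠ [] →
    ∃ t : Tr m, t.interp X = rlist (w.map (codeX X)) ∧ t.flat = w
  | [], h => absurd rfl h
  | [a], _ => ⟨Tr.leaf a, rfl, rfl⟩
  | a :: b :: w, _ => by
    obtain ⟨t, h1, h2⟩ := rlist_tree X (b :: w) (by simp)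
    refine ⟨Tr.node (Tr.leaf a) t, ?_, ?_⟩
    · simp only [Tr.interp, List.map_cons, rlist] at h1 ⊢
      rw [h1]
    · simp [Tr.flat, h2]

/-- A left-nested disjunction of codes is a tree. -/
theorem llistAux_tree {m : ℕ} (X : Fm) : ∀ (w : List (Fin m)) (s : Tr m),
    ∃ t : Tr m, t.interp X = llistAux (s.interp X) (w.map (codeX X)) ∧ t.flat = s.flat ++ w
  | [], s => ⟨s, rfl, by simp⟩
  | a :: w, s => by
    obtain ⟨t, h1, h2⟩ := llistAux_tree X w (Tr.node s (Tr.leaf a))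
    exact ⟨t, h1, by simp [h2, Tr.flat]⟩

theorem llist_tree {m : ℕ} (X : Fm) (w : List (Fin m)) (hw : w ≠ []) :
    ∃ t : Tr m, t.interp X = llist (w.map (codeX X)) ∧ t.flat = w := by
  cases w with
  | nil => exact absurd rfl hw
  | cons a w =>
    obtain ⟨t, h1, h2⟩ := llistAux_tree X w (Tr.leaf a)
    exact ⟨t, h1, by simp [h2, Tr.flat]⟩

theorem rword_tree {m : ℕ} (w : List (Fin m)) (hw : w ≠ []) :
    ∃ t : Tr m, t.interp x0 = rword w ∧ t.flat = w := by
  rw [rword, code_eq]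
  exact rlist_tree x0 w hw

theorem lword_tree {m : ℕ} (w : List (Fin m)) (hw : w ≠ []) :
    ∃ t : Tr m, t.interp x0 = lword w ∧ t.flat = w := by
  rw [lword, code_eq]
  exact llist_tree x0 w hw

theorem ne_nil_of_le {α : Type} {l : List α} {k : ℕ} (hk : 1 ≤ k) (h : k ≤ l.length) :
    l ≠ [] := by
  rintro rfl
  simp at h
  omega

theorem codeSet_tree {m : ℕ} (w : List (Fin m)) (hw : w ≠ []) (F : Fm) (hF : F ∈ CodeSet w) :
    ∃ t : Tr m, F = tri.imp (t.interp x0) ∧ t.flat = w := by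
  rcases hF with ((hF | ⟨a, b, e, ha, hb, hF⟩) | ⟨a, b, c, e, ha, hb, hc, hF⟩) |
    ⟨a, b, e, ha, hb, hF⟩
  · obtain ⟨t, h1, h2⟩ := rword_tree w hw
    exact ⟨t, by rw [h1]; exact hF, h2⟩
  · obtain ⟨s, h1, h2⟩ := rword_tree a (ne_nil_of_le (by omega) ha)
    obtain ⟨t, h3, h4⟩ := rword_tree b (ne_nil_of_le (by omega) hb)
    exact ⟨Tr.node s t, by rw [hF, Tr.interp, h1, h3], by rw [e, Tr.flat, h2, h4]⟩
  · obtain ⟨s, h1, h2⟩ := lword_tree a (ne_nil_of_le (by omega) ha)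
    obtain ⟨t, h3, h4⟩ := rword_tree b (ne_nil_of_le (by omega) hb)
    obtain ⟨u, h5, h6⟩ := rword_tree c (ne_nil_of_le (by omega) hc)
    exact ⟨Tr.node (Tr.node s t) u, by rw [hF, Tr.interp, Tr.interp, h1, h3, h5],
      by rw [e, Tr.flat, Tr.flat, h2, h4, h6]⟩
  · obtain ⟨s, h1, h2⟩ := lword_tree a (ne_nil_of_le (by omega) ha)
    obtain ⟨t, h3, h4⟩ := rword_tree b (ne_nil_of_le (by omega) hb)
    exact ⟨Tr.node s t, by rw [hF, Tr.interp, h1, h3], by rw [e, Tr.flat, h2, h4]⟩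

theorem rlist_cons_ne (A : Fm) : ∀ l : List Fm, l ≠ [] → rlist (A :: l) = orF A (rlist l)
  | [], h => absurd rfl h
  | _ :: _, _ => rfl

/-- Matching a tree with the premise of T1. -/
theorem match_T1 {m : ℕ} (X Y : Fm) : ∀ (w : List (Fin m)) (t : Tr m),
    t.interp X = rlist (w.map (codeX X) ++ [Y]) →
    ∃ s : Tr m, s.interp X = Y ∧ t.flat = w ++ s.flat
  | [], t, h => ⟨t, h, rfl⟩
  | a :: w, t, h => by
    rw [List.map_cons, List.cons_append, rlist_cons_ne _ _ (by simp)] at h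
    obtain ⟨r, q, rfl, h1, h2⟩ := interp_orF h
    obtain ⟨s, h3, h4⟩ := match_T1 X Y w q h2
    rw [interp_code h1]
    exact ⟨s, h3, by simp [Tr.flat, h4]⟩

/-- Code formulas of words produced from ω. -/
def IsCode (T : TagSystem) (ω : List (Fin T.m)) (F : Fm) : Prop :=
  ∃ (X : Fm) (t : Tr T.m), F = (triX X).imp (t.interp X) ∧ TagSteps T ω t.flat

/-- Instances of rule axioms. -/
def IsRule (T : TagSystem) (P₀ : Finset Fm) (F : Fm) : Prop :=
  ∃ A ∈ PTP T P₀, ∃ σ : ℕ → Fm, F = A.subst σ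

theorem isRule_shape {T : TagSystem} {P₀ : Finset Fm} {F : Fm} (h : IsRule T P₀ F) :
    ∃ X D G, F = ((triX X).imp D).imp G := by
  obtain ⟨A, hA, σ, rfl⟩ := h
  rcases hA with (((⟨i, α, -, rfl⟩ | ⟨i, α, -, rfl⟩) | ⟨a, rfl⟩) | ⟨a, rfl⟩) |
    ⟨α, A, -, -, -, rfl⟩ <;>
  exact ⟨_, _, _, rfl⟩

theorem mp_code {T : TagSystem} (hW : ∀ i, T.W i ≠ []) {ω : List (Fin T.m)} {P₀ : Finset Fm}
    {A B : Fm} (hA : IsCode T ω A) (hAB : IsRule T P₀ (A.imp B))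
    (hshort : ∀ α : List (Fin T.m), α ≠ [] → α.length < T.d → A ∉ SubStar (CodeSet α)) :
    IsCode T ω B := by
  obtain ⟨X, t, hAt, ht⟩ := hA
  obtain ⟨R, hR, σ, hσ⟩ := hAB
  rcases hR with (((⟨i, α, hα, rfl⟩ | ⟨i, α, hα, rfl⟩) | ⟨a, rfl⟩) | ⟨a, rfl⟩) |
    ⟨α, A', h0, h1, -, rfl⟩
  · simp only [Fm.subst, Fm.imp.injEq] at hσ
    obtain ⟨hp, hc⟩ := hσ
    rw [hAt, Fm.imp.injEq, tri_subst] at hp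
    obtain ⟨hX, hp⟩ := hp
    have hX := triX_inj hX
    have hm : (Fm.subst σ ∘ (code : Fin T.m → Fm)) = codeX X := by
      funext j
      rw [hX]
      exact code_subst σ j
    rw [rlist_subst _ _ (by simp), List.map_append, List.map_map, hm] at hp
    obtain ⟨s, hs1, hs2⟩ := match_T1 X _ _ _ hp
    rw [rlist_subst _ _ (by simp), List.map_cons, List.map_map, hm,
      rlist_cons_ne _ _ (by simpa using hW i), tri_subst, ← hX] at hc
    obtain ⟨u, hu1, hu2⟩ := rlist_tree X (T.W i) (hW i)
    refine ⟨X, Tr.node s u, ?_, ht.tail ⟨i, α, s.flat, hα, hs2, ?_⟩⟩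
    · rw [hc, Tr.interp, hs1, hu1]
    · rw [Tr.flat, hu2]
  · simp only [Fm.subst, Fm.imp.injEq] at hσ
    obtain ⟨hp, hc⟩ := hσ
    rw [hAt, Fm.imp.injEq, tri_subst] at hp
    obtain ⟨hX, hp⟩ := hp
    have hX := triX_inj hX
    rw [rword_subst _ _ (by simp), ← hX] at hp
    rw [rword_subst _ _ (hW i), tri_subst, ← hX] at hc
    obtain ⟨v, hv1, hv2⟩ := rlist_tree X (i :: α) (by simp)
    obtain ⟨u, hu1, hu2⟩ := rlist_tree X (T.W i) (hW i)
    have := interp_inj X t v (hp.trans hv1.symm)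
    subst this
    refine ⟨X, u, ?_, ht.tail ⟨i, α, [], hα, ?_, ?_⟩⟩
    · rw [hc, hu1]
    · simpa using hv2
    · simpa using hu2
  · simp only [Fm.subst, Fm.imp.injEq, orF_subst] at hσ
    obtain ⟨hp, hc⟩ := hσ
    rw [hAt, Fm.imp.injEq, tri_subst] at hp
    obtain ⟨hX, hp⟩ := hp
    have hX := triX_inj hX
    rw [code_subst, ← hX] at hp
    rw [code_subst, tri_subst, ← hX] at hc
    obtain ⟨p, u, rfl, hp, hu⟩ := interp_orF hp
    obtain ⟨y, p, rfl, hy, hp⟩ := interp_orF hp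
    obtain ⟨q, z, rfl, hq, hz⟩ := interp_orF hp
    have := interp_code hq
    subst this
    refine ⟨X, Tr.node (Tr.node (Tr.node y (Tr.leaf a)) z) u, ?_, ?_⟩
    · simp only [Tr.interp] at *
      rw [hc, hy, hz, hu]
    · simpa [Tr.flat] using ht
  · simp only [Fm.subst, Fm.imp.injEq, orF_subst] at hσ
    obtain ⟨hp, hc⟩ := hσ
    rw [hAt, Fm.imp.injEq, tri_subst] at hp
    obtain ⟨hX, hp⟩ := hp
    have hX := triX_inj hX
    rw [code_subst, ← hX] at hp
    rw [code_subst, tri_subst, ← hX] at hc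
    obtain ⟨p, z, rfl, hp, hz⟩ := interp_orF hp
    obtain ⟨y, q, rfl, hy, hq⟩ := interp_orF hp
    have := interp_code hq
    subst this
    refine ⟨X, Tr.node y (Tr.node (Tr.leaf a) z), ?_, ?_⟩
    · simp only [Tr.interp] at *
      rw [hc, hy, hz]
    · simpa [Tr.flat] using ht
  · exfalso
    rw [Fm.subst, Fm.imp.injEq] at hσ
    exact hshort α (List.length_pos_iff.mp h0) h1
      ⟨_, Or.inl (Or.inl (Or.inl rfl)), σ, hσ.1⟩

theorem stages_inv (T : TagSystem) (hW : ∀ i, T.W i ≠ [])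
    (ω : List (Fin T.m)) (hω : ω ≠ []) (P₀ : Finset Fm) (n : ℕ)
    (hn : ∀ k < n, ∀ α : List (Fin T.m), α ≠ [] → α.length < T.d →
      SubStar (CodeSet α) ∩ Stages (PTot T ω P₀) k = ∅) (k : ℕ) :
    k ≤ n → ∀ F ∈ Stages (PTot T ω P₀) k, IsCode T ω F ∨ IsRule T P₀ F := by
  induction k with
  | zero =>
    intro _ F hF
    rcases hF with hF | hF
    · left
      obtain ⟨t, h1, h2⟩ := rword_tree ω hω
      refine ⟨x0, t, by rw [hF, h1]; rfl, ?_⟩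
      rw [h2]
      exact Relation.ReflTransGen.refl
    · exact Or.inr ⟨F, hF, Fm.var, (subst_id F).symm⟩
  | succ k ih =>
    intro hk F hF
    have ih := ih (by omega)
    rcases hF with ⟨A, hA, hAF⟩ | ⟨A, hA, σ, rfl⟩
    · have hA' := ih A hA
      rcases ih _ hAF with ⟨X, t, h1, -⟩ | hR
      · exfalso
        rw [Fm.imp.injEq] at h1
        rcases hA' with ⟨Y, s, h2, -⟩ | hR
        · exact triX_ne _ _ _ (h1.1.symm.trans h2)
        · obtain ⟨Y, D, G, h2⟩ := isRule_shape hR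
          exact triX_ne' _ _ _ _ (h1.1.symm.trans h2)
      · rcases hA' with hC | hR'
        · left
          refine mp_code hW hC hR fun α h1 h2 h3 => ?_
          have := hn k (by omega) α h1 h2
          exact Set.notMem_empty A (this ▸ ⟨h3, hA⟩)
        · exfalso
          obtain ⟨X, D, G, h1⟩ := isRule_shape hR
          obtain ⟨Y, D', G', h2⟩ := isRule_shape hR'
          rw [Fm.imp.injEq] at h1
          have h3 := h1.1.symm.trans h2
          rw [Fm.imp.injEq] at h3
          exact triX_ne _ _ _ h3.1
    · rcases ih A hA with ⟨X, t, rfl, ht⟩ | ⟨R, hR, τ, rfl⟩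
      · left
        exact ⟨X.subst σ, t, by rw [Fm.subst, triX_subst, interp_subst], ht⟩
      · right
        exact ⟨R, hR, _, subst_comp _ _ _⟩

/-- For n ≤ N_ω, if a substitution instance of a code of the nonempty word α lies in
    ⟨P_{T,ω,P₀}⟩_n, then ω ⟹_T α. -/
theorem stmt_16 (T : TagSystem) (hW : ∀ i, T.W i ≠ []) (hd : 1 ≤ T.d)
    (ω : List (Fin T.m)) (hω : ω ≠ []) (P₀ : Finset Fm)
    (hx0 : ∀ A ∈ P₀, ¬ Occurs 0 A) (n : ℕ)
    (hn : ∀ k < n, ∀ α : List (Fin T.m), α ≠ [] → α.length < T.d →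
      SubStar (CodeSet α) ∩ Stages (PTot T ω P₀) k = ∅)
    (α : List (Fin T.m)) (hα : α ≠ [])
    (h : ∃ F ∈ SubStar (CodeSet α), F ∈ Stages (PTot T ω P₀) n) :
    TagSteps T ω α := by
  obtain ⟨F, ⟨A, hA, σ, rfl⟩, hF⟩ := h
  obtain ⟨s, rfl, hs⟩ := codeSet_tree α hα A hA
  rw [Fm.subst, tri_subst, interp_subst, x0_subst] at hF
  rcases stages_inv T hW ω hω P₀ n hn n le_rfl _ hF with ⟨X, t, h1, ht⟩ | hR
  · rw [Fm.imp.injEq] at h1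
    have hX := triX_inj h1.1
    have h2 := h1.2
    rw [hX] at h2
    rw [← hs, interp_inj X s t h2]
    exact ht
  · exfalso
    obtain ⟨X, D, G, h1⟩ := isRule_shape hR
    rw [Fm.imp.injEq] at h1
    exact triX_ne _ _ _ h1.1
end
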